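/- arXiv:2602.01920 — 2 statements merged into one kernel-verified Lean document; each statement's English description precedes it below -/
import Mathlib

section
/- Let L be a real symmetric positive semidefinite N×N matrix and let κ > 0, Δt > 0. Suppose λ₂ > 0 is such that xᵀLx ≥ λ₂‖x‖² for every vector x orthogonal to the kernel of L. Let G = (I + Δt·κ·L)⁻¹ (which exists since I + Δt·κ·L is positive definite), and let S, U* ∈ ℝᴺ satisfy κ·L·U* = S. Define the sequence U⁽ᵗ⁺¹⁾ = G(U⁽ᵗ⁾ + Δt·S) from an initial vector U⁽⁰⁾ with U⁽⁰⁾ − U* orthogonal to the kernel of L. Then for every t ≥ 0, U⁽ᵗ⁾ − U* = Gᵗ(U⁽⁰⁾ − U*) and ‖U⁽ᵗ⁾ − U*‖₂ ≤ (1/(1 + Δt·κ·λ₂))ᵗ · ‖U⁽⁰⁾ − U*‖₂. -/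
open Matrix Finset

/-- Euclidean norm on `ℝᴺ`. -/
noncomputable def eucNorm {N : ℕ} (x : Fin N → ℝ) : ℝ :=
  Real.sqrt (∑ i, (x i) ^ 2)

theorem eucNorm_eq_sqrt_dotProduct {N : ℕ} (x : Fin N → ℝ) :
    eucNorm x = Real.sqrt (x ⬝ᵥ x) := by
  simp only [eucNorm, dotProduct, pow_two]

/-- A lower bound `k * ‖w‖² ≤ ⟪v, w⟫` yields the contraction estimate `‖w‖ ≤ k⁻¹ * ‖v‖`. -/
theorem eucNorm_le_of_mul_dotProduct_le {N : ℕ} {v w : Fin N → ℝ} {k : ℝ} (hk : 0 < k)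
    (h : k * (w ⬝ᵥ w) ≤ v ⬝ᵥ w) : eucNorm w ≤ 1 / k * eucNorm v := by
  have hsq : k ^ 2 * (w ⬝ᵥ w) ≤ v ⬝ᵥ v := by
    have hnn : 0 ≤ (v - k • w) ⬝ᵥ (v - k • w) :=
      Finset.sum_nonneg fun i _ => mul_self_nonneg ((v - k • w) i)
    simp only [sub_dotProduct, dotProduct_sub, smul_dotProduct, dotProduct_smul,
      smul_eq_mul, dotProduct_comm w v] at hnn
    nlinarith [mul_le_mul_of_nonneg_left h hk.le]
  rw [one_div, ← div_eq_inv_mul, le_div_iff₀' hk, eucNorm_eq_sqrt_dotProduct,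
    eucNorm_eq_sqrt_dotProduct, ← Real.sqrt_sq hk.le, ← Real.sqrt_mul (sq_nonneg k)]
  exact Real.sqrt_le_sqrt hsq

/-- For symmetric `L`, the resolvent equation `(1 + c L) w = v` does not change the pairing
with the kernel of `L`. -/
theorem dotProduct_add_smul_mulVec_of_mulVec_eq_zero {N : ℕ} {L : Matrix (Fin N) (Fin N) ℝ}
    (hL : L.IsSymm) (c : ℝ) (w : Fin N → ℝ) {y : Fin N → ℝ} (hy : L *ᵥ y = 0) :
    (w + c • L *ᵥ w) ⬝ᵥ y = w ⬝ᵥ y := by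
  have h : (L *ᵥ w) ⬝ᵥ y = 0 := by
    rw [← vecMul_transpose, hL.eq, ← dotProduct_mulVec, hy, dotProduct_zero]
  rw [add_dotProduct, smul_dotProduct, h, smul_zero, add_zero]

/-- **Thermodynamic Phase Convergence.** The implicit-Euler heat-diffusion iteration
`(I + Δt·κ·L) U⁽ᵗ⁺¹⁾ = U⁽ᵗ⁾ + Δt·S` converges geometrically to the equilibrium `U*`
with rate governed by the spectral gap `λ₂` of `L`. -/
theorem thermodynamic_phase_convergence
    {N : ℕ} (L G : Matrix (Fin N) (Fin N) ℝ)
    (κ Δt lam2 : ℝ) (hκ : 0 < κ) (hΔt : 0 < Δt) (hlam2 : 0 < lam2)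
    (hLsymm : L.IsSymm)
    (hLpsd : ∀ x : Fin N → ℝ, 0 ≤ x ⬝ᵥ L.mulVec x)
    (hgap : ∀ x : Fin N → ℝ, (∀ y : Fin N → ℝ, L.mulVec y = 0 → x ⬝ᵥ y = 0) →
      lam2 * (x ⬝ᵥ x) ≤ x ⬝ᵥ L.mulVec x)
    (hG1 : G * (1 + (Δt * κ) • L) = 1) (hG2 : (1 + (Δt * κ) • L) * G = 1)
    (S Ustar : Fin N → ℝ) (hS : κ • L.mulVec Ustar = S)
    (U : ℕ → Fin N → ℝ)
    (hU0 : ∀ y : Fin N → ℝ, L.mulVec y = 0 → (U 0 - Ustar) ⬝ᵥ y = 0)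
    (hrec : ∀ t : ℕ, U (t + 1) = G.mulVec (U t + Δt • S)) :
    ∀ t : ℕ, U t - Ustar = (G ^ t).mulVec (U 0 - Ustar) ∧
      eucNorm (U t - Ustar) ≤ (1 / (1 + Δt * κ * lam2)) ^ t * eucNorm (U 0 - Ustar) := by
  set c := Δt * κ with hc
  set k := 1 + c * lam2 with hk
  have hcpos : 0 < c := mul_pos hΔt hκ
  have hkpos : 0 < k := by positivity
  have hres : ∀ v, G *ᵥ v + c • L *ᵥ (G *ᵥ v) = v := fun v => by
    have h := congrArg (· *ᵥ v) hG2
    simpa only [← mulVec_mulVec, add_mulVec, smul_mulVec, one_mulVec] using h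
  have hfix : G *ᵥ (Ustar + Δt • S) = Ustar := by
    have h := congrArg (· *ᵥ Ustar) hG1
    simpa only [← mulVec_mulVec, add_mulVec, smul_mulVec, one_mulVec, hc, mul_smul, hS] using h
  have hstep : ∀ t, U (t + 1) - Ustar = G *ᵥ (U t - Ustar) := fun t => by
    conv_lhs => rw [hrec t, ← hfix]
    rw [← mulVec_sub, add_sub_add_right_eq_sub]
  have horth : ∀ t y, L *ᵥ y = 0 → (U t - Ustar) ⬝ᵥ y = 0 := by
    intro t
    induction t with
    | zero => exact hU0
    | succ t ih =>
      intro y hy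
      rw [hstep, ← dotProduct_add_smul_mulVec_of_mulVec_eq_zero hLsymm c _ hy, hres]
      exact ih y hy
  have hcontr : ∀ t, eucNorm (U (t + 1) - Ustar) ≤ 1 / k * eucNorm (U t - Ustar) := fun t => by
    apply eucNorm_le_of_mul_dotProduct_le hkpos
    have hg := mul_le_mul_of_nonneg_left (hgap _ (horth (t + 1))) hcpos.le
    have hv : U t - Ustar = (U (t + 1) - Ustar) + c • L *ᵥ (U (t + 1) - Ustar) := by
      rw [hstep, hres]
    rw [hv, add_dotProduct, smul_dotProduct, smul_eq_mul, dotProduct_comm (L *ᵥ _)]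
    linarith
  intro t
  induction t with
  | zero => simp
  | succ t ih =>
    refine ⟨by rw [hstep, ih.1, mulVec_mulVec, pow_succ'], (hcontr t).trans ?_⟩
    rw [pow_succ', mul_assoc]
    exact mul_le_mul_of_nonneg_left ih.2 (by positivity)
end

section
/- Let A be a real symmetric N×N matrix with nonnegative entries, let L = D − A be its graph Laplacian, and let K > 0, r_min > 0, λ > 0 be constants such that xᵀLx ≥ λ·‖x‖² for every x ∈ ℝᴺ with Σᵢ xᵢ = 0. Let ω ∈ ℝᴺ and let θ : ℝ → ℝᴺ be twice differentiable with θ̇ᵢ(t) = ωᵢ + K·Σⱼ Aᵢⱼ·sin(θⱼ(t) − θᵢ(t)) for all i and all t ≥ 0, and suppose that cos(θⱼ(t) − θᵢ(t)) ≥ r_min for all t ≥ 0 and all pairs (i, j) with Aᵢⱼ > 0. Define Ωᵢ(t) = θ̇ᵢ(t), Ω̄(t) = (1/N)·Σᵢ Ωᵢ(t), and V(t) = (1/2)·Σᵢ (Ωᵢ(t) − Ω̄(t))². Then for all t ≥ 0, V(t) ≤ V(0)·exp(−2·K·λ·r_min·t), and consequently maxᵢ,ⱼ |Ωᵢ(t)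 − Ωⱼ(t)| ≤ 2·√(2·V(0))·exp(−K·λ·r_min·t), i.e. the oscillators achieve frequency synchronisation exponentially fast. -/
open Matrix Finset

/-- Summation by parts on a symmetrically weighted graph. -/
lemma sum_mul_sum_symm_weight_mul_sub {ι : Type*} [Fintype ι] (w : ι → ι → ℝ)
    (hw : ∀ i j, w i j = w j i) (x : ι → ℝ) :
    ∑ i, x i * ∑ j, w i j * (x j - x i) = -(1 / 2) * ∑ i, ∑ j, w i j * (x j - x i) ^ 2 := by
  have hswap : ∑ i, ∑ j, x i * (w i j * (x j - x i)) =
      ∑ i, ∑ j, x j * (w i j * (x i - x j)) := by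
    rw [Finset.sum_comm]
    refine Finset.sum_congr rfl fun i _ => Finset.sum_congr rfl fun j _ => ?_
    rw [hw]
  have hsum : ∑ i, ∑ j, x i * (w i j * (x j - x i)) + ∑ i, ∑ j, x j * (w i j * (x i - x j)) =
      -∑ i, ∑ j, w i j * (x j - x i) ^ 2 := by
    simp only [← Finset.sum_add_distrib, ← Finset.sum_neg_distrib]
    refine Finset.sum_congr rfl fun i _ => Finset.sum_congr rfl fun j _ => ?_
    ring
  rw [Finset.sum_congr rfl fun i _ =>
    Finset.mul_sum Finset.univ (fun j => w i j * (x j - x i)) (x i)]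
  linarith

/-- The quadratic form of the graph Laplacian is the Dirichlet energy. -/
lemma dotProduct_laplacian_mulVec {ι : Type*} [Fintype ι] [DecidableEq ι] (A : Matrix ι ι ℝ)
    (hA : ∀ i j, A i j = A j i) (x : ι → ℝ) :
    x ⬝ᵥ ((Matrix.diagonal (fun i => ∑ j, A i j) - A).mulVec x) =
      (1 / 2) * ∑ i, ∑ j, A i j * (x j - x i) ^ 2 := by
  have h := sum_mul_sum_symm_weight_mul_sub A hA x
  have h' : x ⬝ᵥ ((Matrix.diagonal (fun i => ∑ j, A i j) - A).mulVec x) =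
      -∑ i, x i * ∑ j, A i j * (x j - x i) := by
    rw [Matrix.sub_mulVec, dotProduct, ← Finset.sum_neg_distrib]
    refine Finset.sum_congr rfl fun i _ => ?_
    rw [Pi.sub_apply, Matrix.mulVec_diagonal, Matrix.mulVec, dotProduct]
    simp only [mul_sub, Finset.sum_sub_distrib, Finset.sum_mul]
    ring
  rw [h', h]
  ring

/-- The deviations from the mean sum to zero. -/
lemma sum_sub_mean_eq_zero {N : ℕ} (x : Fin N → ℝ) :
    ∑ i, (x i - 1 / (N : ℝ) * ∑ j, x j) = 0 := by
  rcases Nat.eq_zero_or_pos N with rfl | hN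
  · simp
  · have : (N : ℝ) ≠ 0 := by positivity
    rw [Finset.sum_sub_distrib, Finset.sum_const, Finset.card_univ, Fintype.card_fin,
      nsmul_eq_mul]
    field_simp
    ring

/-- A Gronwall-type bound: `f' ≤ -c f` on `(0, ∞)` forces exponential decay. -/
lemma le_mul_exp_of_hasDerivAt_le {f f' : ℝ → ℝ} {c : ℝ} (hf : ∀ t, HasDerivAt f (f' t) t)
    (hle : ∀ t, 0 < t → f' t ≤ -c * f t) {t : ℝ} (ht : 0 ≤ t) :
    f t ≤ f 0 * Real.exp (-c * t) := by
  have hg : ∀ s, HasDerivAt (fun s => f s * Real.exp (c * s))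
      (f' s * Real.exp (c * s) + f s * (Real.exp (c * s) * (c * 1))) s := fun s =>
    (hf s).mul (((hasDerivAt_id s).const_mul c).exp)
  have hanti : AntitoneOn (fun s => f s * Real.exp (c * s)) (Set.Ici 0) := by
    refine antitoneOn_of_deriv_nonpos (convex_Ici 0)
      (fun s _ => (hg s).continuousAt.continuousWithinAt)
      (fun s _ => (hg s).differentiableAt.differentiableWithinAt) fun s hs => ?_
    rw [interior_Ici] at hs
    rw [(hg s).deriv]
    have := mul_le_mul_of_nonneg_right (hle s hs) (Real.exp_pos (c * s)).le
    linarith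
  have h := hanti Set.self_mem_Ici ht ht
  simp only [mul_zero, Real.exp_zero, mul_one] at h
  rw [neg_mul, Real.exp_neg, ← div_eq_mul_inv]
  exact (le_div_iff₀ (Real.exp_pos _)).2 h

/-- **Synchronisation Phase Stability.** For the Kuramoto dynamics on a graph with
nonnegative symmetric weights `A`, coupling `K > 0`, a uniform lower bound `rmin > 0`
on the edge phase-cosines, and a spectral-gap bound `λ > 0` for the Laplacian
`L = D − A` on mean-zero vectors, the Lyapunov function
`V(t) = (1/2)·Σᵢ (Ωᵢ(t) − Ω̄(t))²` of the instantaneous frequencies `Ωᵢ = θ̇ᵢ`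
decays exponentially, and hence the oscillators achieve frequency synchronisation
exponentially fast. -/
theorem synchronisation_phase_stability
    {N : ℕ} (A : Matrix (Fin N) (Fin N) ℝ)
    (hAsymm : ∀ i j, A i j = A j i) (hAnn : ∀ i j, 0 ≤ A i j)
    (K rmin lam : ℝ) (hK : 0 < K) (hrmin : 0 < rmin) (hlam : 0 < lam)
    (hgap : ∀ x : Fin N → ℝ, (∑ i, x i) = 0 →
      lam * (∑ i, (x i) ^ 2) ≤
        x ⬝ᵥ ((Matrix.diagonal (fun i => ∑ j, A i j) - A).mulVec x))
    (ω : Fin N → ℝ) (θ : ℝ → Fin N → ℝ)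
    (hθsmooth : ∀ i, ContDiff ℝ 2 (fun t => θ t i))
    (hODE : ∀ i, ∀ t : ℝ, 0 ≤ t → deriv (fun s => θ s i) t =
      ω i + K * ∑ j, A i j * Real.sin (θ t j - θ t i))
    (hcos : ∀ t : ℝ, 0 ≤ t → ∀ i j, 0 < A i j → rmin ≤ Real.cos (θ t j - θ t i))
    (Ω : Fin N → ℝ → ℝ) (hΩ : ∀ i t, Ω i t = deriv (fun s => θ s i) t)
    (Ωbar : ℝ → ℝ) (hΩbar : ∀ t, Ωbar t = (1 / (N : ℝ)) * ∑ i, Ω i t)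
    (V : ℝ → ℝ) (hV : ∀ t, V t = (1 / 2) * ∑ i, (Ω i t - Ωbar t) ^ 2) :
    ∀ t : ℝ, 0 ≤ t →
      V t ≤ V 0 * Real.exp (-(2 * K * lam * rmin) * t) ∧
      ∀ i j, |Ω i t - Ω j t| ≤
        2 * Real.sqrt (2 * V 0) * Real.exp (-(K * lam * rmin) * t) := by
  have hΩfun : ∀ i, Ω i = deriv (fun s => θ s i) := fun i => funext (hΩ i)
  have hθd : ∀ i t, HasDerivAt (fun s => θ s i) (Ω i t) t := fun i t => by
    rw [hΩ]
    exact ((hθsmooth i).differentiable (by norm_num) t).hasDerivAt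
  have hΩd : ∀ i t, HasDerivAt (Ω i) (deriv (Ω i) t) t := fun i t => by
    have h : ContDiff ℝ (1 + 1) (fun s => θ s i) := (hθsmooth i).of_le (by norm_num)
    have h1 := (contDiff_succ_iff_deriv.1 h).2.2
    rw [← hΩfun] at h1
    exact (h1.differentiable (by norm_num) t).hasDerivAt
  have hΩ' : ∀ i t, 0 < t → deriv (Ω i) t =
      K * ∑ j, A i j * Real.cos (θ t j - θ t i) * (Ω j t - Ω i t) := by
    intro i t ht
    have heq : Ω i =ᶠ[nhds t] fun s => ω i + K * ∑ j, A i j * Real.sin (θ s j - θ s i) := by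
      filter_upwards [Ioi_mem_nhds ht] with s hs
      rw [hΩ, hODE i s (le_of_lt hs)]
    rw [heq.deriv_eq]
    have hd : HasDerivAt (fun s => ω i + K * ∑ j, A i j * Real.sin (θ s j - θ s i))
        (K * ∑ j, A i j * (Real.cos (θ t j - θ t i) * (Ω j t - Ω i t))) t :=
      ((HasDerivAt.fun_sum fun j _ =>
        (((hθd j t).sub (hθd i t)).sin).const_mul (A i j)).const_mul K).const_add (ω i)
    rw [hd.deriv]
    simp only [mul_assoc]
  have hbard : ∀ t, HasDerivAt Ωbar (1 / (N : ℝ) * ∑ i, deriv (Ω i) t) t := fun t => by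
    rw [funext hΩbar]
    exact (HasDerivAt.fun_sum fun i _ => hΩd i t).const_mul _
  have hmean : ∀ t, ∑ i, (Ω i t - Ωbar t) = 0 := fun t => by
    rw [hΩbar]
    exact sum_sub_mean_eq_zero fun i => Ω i t
  have hVd : ∀ t, HasDerivAt V (∑ i, (Ω i t - Ωbar t) * deriv (Ω i) t) t := fun t => by
    rw [funext hV]
    refine ((HasDerivAt.fun_sum fun i _ =>
      ((hΩd i t).sub (hbard t)).pow 2).const_mul (1 / 2)).congr_deriv ?_
    generalize 1 / (N : ℝ) * ∑ i, deriv (Ω i) t = m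
    have h0 : ∑ i, (Ω i t - Ωbar t) * m = 0 := by rw [← Finset.sum_mul, hmean, zero_mul]
    rw [Finset.mul_sum, ← sub_zero (∑ i, (Ω i t - Ωbar t) * deriv (Ω i) t), ← h0,
      ← Finset.sum_sub_distrib]
    refine Finset.sum_congr rfl fun i _ => ?_
    simp only [Pi.sub_apply]
    push_cast
    ring
  have hdecay : ∀ t, 0 < t →
      ∑ i, (Ω i t - Ωbar t) * deriv (Ω i) t ≤ -(2 * K * lam * rmin) * V t := by
    intro t ht
    have hparts := sum_mul_sum_symm_weight_mul_sub
      (fun i j => A i j * Real.cos (θ t j - θ t i))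
      (fun i j => by rw [hAsymm i j, ← Real.cos_neg, neg_sub]) (fun i => Ω i t - Ωbar t)
    simp only [sub_sub_sub_cancel_right] at hparts
    have hlhs : ∑ i, (Ω i t - Ωbar t) * deriv (Ω i) t = K * ∑ i, (Ω i t - Ωbar t) *
        ∑ j, A i j * Real.cos (θ t j - θ t i) * (Ω j t - Ω i t) := by
      rw [Finset.mul_sum]
      refine Finset.sum_congr rfl fun i _ => ?_
      rw [hΩ' i t ht]
      ring
    have hgapt := hgap (fun i => Ω i t - Ωbar t) (hmean t)
    rw [dotProduct_laplacian_mulVec A hAsymm] at hgapt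
    simp only [sub_sub_sub_cancel_right] at hgapt
    have hweights : rmin * ∑ i, ∑ j, A i j * (Ω j t - Ω i t) ^ 2 ≤
        ∑ i, ∑ j, A i j * Real.cos (θ t j - θ t i) * (Ω j t - Ω i t) ^ 2 := by
      simp only [Finset.mul_sum]
      refine Finset.sum_le_sum fun i _ => Finset.sum_le_sum fun j _ => ?_
      rcases (hAnn i j).eq_or_lt with h | h
      · simp [← h]
      · have := mul_le_mul_of_nonneg_right (hcos t ht.le i j h)
          (mul_nonneg h.le (sq_nonneg (Ω j t - Ω i t)))
        linarith
    have h1 := mul_le_mul_of_nonneg_left hweights hK.le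
    have h2 := mul_le_mul_of_nonneg_left hgapt (mul_pos hK hrmin).le
    rw [hlhs, hparts, hV]
    linarith
  intro t ht
  have hVt := le_mul_exp_of_hasDerivAt_le hVd hdecay ht
  refine ⟨hVt, fun i j => ?_⟩
  have hdev : ∀ k, |Ω k t - Ωbar t| ≤ √(2 * V 0) * Real.exp (-(K * lam * rmin) * t) := by
    intro k
    have hk : (Ω k t - Ωbar t) ^ 2 ≤ 2 * V t := by
      have := Finset.single_le_sum (f := fun i => (Ω i t - Ωbar t) ^ 2)
        (fun i _ => sq_nonneg _) (Finset.mem_univ k)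
      rw [hV]
      linarith
    have hV0 : 0 ≤ 2 * V 0 := by
      rw [hV]
      positivity
    refine abs_le_of_sq_le_sq ?_ (by positivity)
    rw [mul_pow, Real.sq_sqrt hV0, ← Real.exp_nat_mul]
    have hexp : ((2 : ℕ) : ℝ) * (-(K * lam * rmin) * t) = -(2 * K * lam * rmin) * t := by
      push_cast
      ring
    rw [hexp]
    linarith
  calc |Ω i t - Ω j t| ≤ |Ω i t - Ωbar t| + |Ωbar t - Ω j t| := abs_sub_le _ _ _
    _ = |Ω i t - Ωbar t| + |Ω j t - Ωbar t| := by rw [abs_sub_comm (Ωbar t)]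
    _ ≤ _ := by linarith [hdev i, hdev j]
end
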